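/- arXiv:1907.08115 — 4 statements merged into one kernel-verified Lean document; each statement's English description precedes it below -/
import Mathlib

section
/- Let P be a projective plane and let S be a set of six distinct points of P. If some line contains exactly four points of S and some line contains exactly three points of S, then the number of secant lines of S is exactly 8. (This is the count n_4 = 8 in case 4 of the combinatorial table in the proof of Lemma 3.) -/
open Configuration in
/-- If a finite set of points `S` is covered by two lines `l` and `l'`, then the secants of `S`
other than `l` and `l'` are the lines joining a point of `S` on `l` only to a point of `S` on `l'`
only, and these joining lines are pairwise distinct. -/
theorem ncard_secants_diff_of_subset_two_lines
    {P L : Type*} [Membership P L] [HasLines P L] {S : Set P} (hS : S.Finite) {l l' : L}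
    (hcover : ∀ p ∈ S, p ∈ l ∨ p ∈ l') :
    ({m : L | 2 ≤ {p : P | p ∈ S ∧ p ∈ m}.ncard} \ {l, l'}).ncard =
      {p : P | (p ∈ S ∧ p ∈ l) ∧ p ∉ l'}.ncard * {p : P | (p ∈ S ∧ p ∈ l') ∧ p ∉ l}.ncard := by
  have eq_line {p q : P} {m n : L} (hpq : p ≠ q) (hpm : p ∈ m) (hqm : q ∈ m) (hpn : p ∈ n)
      (hqn : q ∈ n) : m = n := (Nondegenerate.eq_or_eq hpm hqm hpn hqn).resolve_left hpq
  have exists_line (x : P × P) : ∃ m : L, x.1 ≠ x.2 → x.1 ∈ m ∧ x.2 ∈ m := by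
    by_cases h : x.1 = x.2
    · exact ⟨l, fun h' => absurd h h'⟩
    · exact ⟨HasLines.mkLine h, fun _ => HasLines.mkLine_ax h⟩
  choose f hf using exists_line
  have f_spec {p q : P} (hp : p ∈ l) (hq : q ∉ l) : p ∈ f (p, q) ∧ q ∈ f (p, q) :=
    hf (p, q) (fun h : p = q => hq (h ▸ hp))
  rw [← Set.ncard_prod]
  symm
  refine Set.ncard_congr (fun x _ => f x) ?_ ?_ ?_
  · rintro ⟨p, q⟩ ⟨⟨⟨hpS, hpl⟩, hpl'⟩, ⟨hqS, hql'⟩, hql⟩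
    obtain ⟨hpf, hqf⟩ := f_spec hpl hql
    refine ⟨(Set.one_lt_ncard_iff (hS.subset fun _ h => h.1)).2
      ⟨p, q, ⟨hpS, hpf⟩, ⟨hqS, hqf⟩, fun h => hql (h ▸ hpl)⟩, ?_⟩
    rintro (h | h)
    · exact hql (h ▸ hqf)
    · exact hpl' (h ▸ hpf)
  · rintro ⟨p, q⟩ ⟨p', q'⟩ ⟨⟨⟨-, hpl⟩, hpl'⟩, ⟨-, hql'⟩, hql⟩
      ⟨⟨⟨-, hpl₂⟩, hpl₂'⟩, ⟨-, hql₂'⟩, hql₂⟩ h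
    obtain ⟨hpf, hqf⟩ := f_spec hpl hql
    obtain ⟨hpf', hqf'⟩ := f_spec hpl₂ hql₂
    have h : f (p, q) = f (p', q') := h
    rw [← h] at hpf' hqf'
    refine Prod.ext ?_ ?_
    · by_contra hne
      exact hql (eq_line hne hpf hpf' hpl hpl₂ ▸ hqf)
    · by_contra hne
      exact hpl' (eq_line hne hqf hqf' hql' hql₂' ▸ hpf)
  · rintro m ⟨hm, hne⟩
    simp only [Set.mem_insert_iff, Set.mem_singleton_iff, not_or] at hne
    obtain ⟨x, y, ⟨hxS, hxm⟩, ⟨hyS, hym⟩, hxy⟩ :=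
      (Set.one_lt_ncard_iff (hS.subset fun _ h => h.1)).1 hm
    have not_both_l : ¬(x ∈ l ∧ y ∈ l) := fun h => hne.1 (eq_line hxy hxm hym h.1 h.2)
    have not_both_l' : ¬(x ∈ l' ∧ y ∈ l') := fun h => hne.2 (eq_line hxy hxm hym h.1 h.2)
    have hx := hcover x hxS
    have hy := hcover y hyS
    by_cases hxl : x ∈ l
    · have hyl : y ∉ l := fun h => not_both_l ⟨hxl, h⟩
      have hyl' := hy.resolve_left hyl
      obtain ⟨h₁, h₂⟩ := f_spec hxl hyl
      exact ⟨(x, y), ⟨⟨⟨hxS, hxl⟩, fun h => not_both_l' ⟨h, hyl'⟩⟩, ⟨hyS, hyl'⟩, hyl⟩,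
        eq_line hxy h₁ h₂ hxm hym⟩
    · have hxl' := hx.resolve_left hxl
      have hyl' : y ∉ l' := fun h => not_both_l' ⟨hxl', h⟩
      have hyl := hy.resolve_right hyl'
      obtain ⟨h₁, h₂⟩ := f_spec hyl hxl
      exact ⟨(y, x), ⟨⟨⟨hyS, hyl⟩, hyl'⟩, ⟨hxS, hxl'⟩, hxl⟩, eq_line hxy h₂ h₁ hxm hym⟩


/-- Case 4 of the combinatorial table in the proof of Lemma 3:
if some line of a projective plane contains exactly four points of a six-point
set `S` and some line contains exactly three points of `S`, then `S` has
exactly `8` secant lines (lines containing at least two points of `S`). -/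
theorem secant_count_of_line_with_four_points_and_three
    {P L : Type*} [Membership P L] [Configuration.ProjectivePlane P L]
    (S : Set P) (hS : S.ncard = 6)
    (h4 : ∃ l : L, {p : P | p ∈ S ∧ p ∈ l}.ncard = 4)
    (h3 : ∃ l : L, {p : P | p ∈ S ∧ p ∈ l}.ncard = 3) :
    {m : L | 2 ≤ {p : P | p ∈ S ∧ p ∈ m}.ncard}.ncard = 8 := by
  obtain ⟨l, hl⟩ := h4
  obtain ⟨l', hl'⟩ := h3
  have hfin : S.Finite := Set.finite_of_ncard_ne_zero (by omega)
  have hne : l ≠ l' := by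
    rintro rfl
    omega
  have hX : {p : P | p ∈ S ∧ p ∈ l}.Finite := hfin.subset fun _ h => h.1
  have hY : {p : P | p ∈ S ∧ p ∈ l'}.Finite := hfin.subset fun _ h => h.1
  have hinter : ({p : P | p ∈ S ∧ p ∈ l} ∩ {p : P | p ∈ S ∧ p ∈ l'}).ncard ≤ 1 :=
    (Set.ncard_le_one (hX.inter_of_left _)).2 fun _ ha _ hb =>
      (Configuration.Nondegenerate.eq_or_eq ha.1.2 hb.1.2 ha.2.2 hb.2.2).resolve_right hne
  have hsub : {p : P | p ∈ S ∧ p ∈ l} ∪ {p : P | p ∈ S ∧ p ∈ l'} ⊆ S :=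
    Set.union_subset (fun _ h => h.1) fun _ h => h.1
  have hle := Set.ncard_le_ncard hsub hfin
  have hadd := Set.ncard_union_add_ncard_inter _ _ hX hY
  have hunion := Set.eq_of_subset_of_ncard_le hsub (by omega) hfin
  have hcover : ∀ p ∈ S, p ∈ l ∨ p ∈ l' := fun p hp =>
    (hunion.symm.subset hp).imp And.right And.right
  have hA : {p : P | (p ∈ S ∧ p ∈ l) ∧ p ∉ l'}.ncard = 3 := by
    have h := Set.ncard_inter_add_ncard_sdiff_eq_ncard
      {p : P | p ∈ S ∧ p ∈ l} {p : P | p ∈ S ∧ p ∈ l'} hX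
    have heq : {p : P | (p ∈ S ∧ p ∈ l) ∧ p ∉ l'} =
        {p : P | p ∈ S ∧ p ∈ l} \ {p : P | p ∈ S ∧ p ∈ l'} := by
      ext p
      simp only [Set.mem_sdiff, Set.mem_ofPred_eq]
      tauto
    rw [heq]
    omega
  have hB : {p : P | (p ∈ S ∧ p ∈ l') ∧ p ∉ l}.ncard = 2 := by
    have h := Set.ncard_inter_add_ncard_sdiff_eq_ncard
      {p : P | p ∈ S ∧ p ∈ l'} {p : P | p ∈ S ∧ p ∈ l} hY
    have heq : {p : P | (p ∈ S ∧ p ∈ l') ∧ p ∉ l} =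
        {p : P | p ∈ S ∧ p ∈ l'} \ {p : P | p ∈ S ∧ p ∈ l} := by
      ext p
      simp only [Set.mem_sdiff, Set.mem_ofPred_eq]
      tauto
    rw [Set.inter_comm] at h
    rw [heq]
    omega
  have hdiff := ncard_secants_diff_of_subset_two_lines hfin hcover
  rw [hA, hB] at hdiff
  have hpair : ({l, l'} : Set L) ⊆ {m : L | 2 ≤ {p : P | p ∈ S ∧ p ∈ m}.ncard} := by
    rintro m (rfl | rfl) <;> rw [Set.mem_ofPred_eq] <;> omega
  rw [← Set.sdiff_union_of_subset hpair, Set.ncard_union_eq Set.disjoint_sdiff_left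
    (Set.finite_of_ncard_ne_zero (by omega)) (Set.toFinite _), hdiff, Set.ncard_pair hne]
end

section
/- Let P be a projective plane and let x₁, …, x₆ be six distinct points of P. Let L₁ be the line through x₁, x₂, x₃, let L₂ be the line through x₃, x₄, x₅, and let L₃ be the line through x₅, x₆, x₁. Assume that no line of P contains four or more of the six points and that L₁, L₂, L₃ are the only lines containing exactly three of the six points. Then every collinearity-preserving bijection σ of the points of P with σ({x₁,…,x₆}) = {x₁,…,x₆} maps the set {x₁, x₃, x₅} onto itself; in particular, no group of collinearity-preserving bijections preserving {x₁,…,x₆} acts transitively on {x₁,…,x₆}. (This is the argument ruling out case 8 in the proof of Lemma 3.) -/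
open Configuration

/-- A point `p` of `S` lying on two collinear triples of points of `S` that meet only in `p`. -/
def IsTriangleVertex {P : Type*} (L : Type*) [Membership P L] (S : Set P) (p : P) : Prop :=
  ∃ a ∈ S, ∃ b ∈ S, ∃ c ∈ S, ∃ d ∈ S, [p, a, b, c, d].Nodup ∧
    (∃ m : L, p ∈ m ∧ a ∈ m ∧ b ∈ m) ∧ ∃ m : L, p ∈ m ∧ c ∈ m ∧ d ∈ m

theorem IsTriangleVertex.map {P L : Type*} [Membership P L] {S : Set P} {p : P}
    (hp : IsTriangleVertex L S p) {σ : P → P} (hinj : Function.Injective σ)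
    (hσ : ∀ a b c : P, (∃ m : L, a ∈ m ∧ b ∈ m ∧ c ∈ m) →
      ∃ m : L, σ a ∈ m ∧ σ b ∈ m ∧ σ c ∈ m)
    (hS : Set.MapsTo σ S S) : IsTriangleVertex L S (σ p) := by
  obtain ⟨a, ha, b, hb, c, hc, d, hd, hnd, hab, hcd⟩ := hp
  exact ⟨σ a, hS ha, σ b, hS hb, σ c, hS hc, σ d, hS hd, hnd.map hinj, hσ _ _ _ hab, hσ _ _ _ hcd⟩

theorem List.Nodup.length_le_ncard {α : Type*} {l : List α} (hl : l.Nodup) {S : Set α}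
    (hS : S.Finite) (h : ∀ x ∈ l, x ∈ S) : l.length ≤ S.ncard := by
  classical
  rw [← List.toFinset_card_of_nodup hl, ← Set.ncard_coe_finset]
  exact Set.ncard_le_ncard (fun x hx => h x (by simpa using hx)) hS

/-- If no line meets the finite set `S` in more than three points, a vertex of `S` lies on two
distinct lines meeting `S` in exactly three points. -/
theorem IsTriangleVertex.exists_ne_lines {P L : Type*} [Membership P L] {S : Set P}
    (hS : S.Finite) (h4 : ∀ m : L, {p | p ∈ S ∧ p ∈ m}.ncard < 4) {p : P} (hpS : p ∈ S)
    (hp : IsTriangleVertex L S p) :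
    ∃ m n : L, m ≠ n ∧ p ∈ m ∧ p ∈ n ∧
      {p | p ∈ S ∧ p ∈ m}.ncard = 3 ∧ {p | p ∈ S ∧ p ∈ n}.ncard = 3 := by
  obtain ⟨a, ha, b, hb, c, hc, d, hd, hnd, ⟨m, hpm, ham, hbm⟩, n, hpn, hcn, hdn⟩ := hp
  have hfin (k : L) : {p | p ∈ S ∧ p ∈ k}.Finite := hS.subset fun _ h => h.1
  have h3 (k : L) (u v : P) (hu : u ∈ S) (hv : v ∈ S) (huv : [p, u, v].Nodup) (hpk : p ∈ k)
      (huk : u ∈ k) (hvk : v ∈ k) : {p | p ∈ S ∧ p ∈ k}.ncard = 3 :=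
    le_antisymm (Nat.lt_succ_iff.mp (h4 k)) (huv.length_le_ncard (hfin k) (by simp [*]))
  refine ⟨m, n, ?_, hpm, hpn, h3 m a b ha hb (hnd.sublist (by simp)) hpm ham hbm,
    h3 n c d hc hd (by simp at hnd ⊢; tauto) hpn hcn hdn⟩
  rintro rfl
  have := hnd.length_le_ncard (hfin m) (by simp [*])
  have := h4 m
  simp at *
  omega

theorem nodup_of_ncard_eq_six {α : Type*} {a b c d e f : α}
    (h : ({a, b, c, d, e, f} : Set α).ncard = 6) : [a, b, c, d, e, f].Nodup := by
  classical
  rw [← Multiset.coe_nodup, ← Multiset.toFinset_card_eq_card_iff_nodup, ← Set.ncard_coe_finset]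
  simpa using h

/-- The argument ruling out case 8 in the proof of Lemma 3: let `x₁, …, x₆` be
six distinct points of a projective plane, let `L₁` pass through `x₁, x₂, x₃`,
`L₂` through `x₃, x₄, x₅` and `L₃` through `x₅, x₆, x₁`, suppose no line
contains four or more of the six points and that `L₁, L₂, L₃` are the only
lines containing exactly three of them.  Then every collinearity-preserving
bijection `σ` preserving `{x₁, …, x₆}` maps `{x₁, x₃, x₅}` onto itself; in
particular no group of collinearity-preserving bijections preserving
`{x₁, …, x₆}` acts transitively on it. -/
theorem no_transitive_action_of_triangle_config
    {P L : Type*} [Membership P L] [Configuration.ProjectivePlane P L]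
    (x₁ x₂ x₃ x₄ x₅ x₆ : P)
    (hdist : ({x₁, x₂, x₃, x₄, x₅, x₆} : Set P).ncard = 6)
    (L₁ L₂ L₃ : L)
    (hL₁ : x₁ ∈ L₁ ∧ x₂ ∈ L₁ ∧ x₃ ∈ L₁)
    (hL₂ : x₃ ∈ L₂ ∧ x₄ ∈ L₂ ∧ x₅ ∈ L₂)
    (hL₃ : x₅ ∈ L₃ ∧ x₆ ∈ L₃ ∧ x₁ ∈ L₃)
    (h4 : ∀ m : L,
      {p : P | p ∈ ({x₁, x₂, x₃, x₄, x₅, x₆} : Set P) ∧ p ∈ m}.ncard < 4)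
    (honly : ∀ m : L,
      {p : P | p ∈ ({x₁, x₂, x₃, x₄, x₅, x₆} : Set P) ∧ p ∈ m}.ncard = 3 →
      m = L₁ ∨ m = L₂ ∨ m = L₃) :
    (∀ σ : Equiv.Perm P,
      (∀ a b c : P, (∃ m : L, a ∈ m ∧ b ∈ m ∧ c ∈ m) ↔
        (∃ m : L, σ a ∈ m ∧ σ b ∈ m ∧ σ c ∈ m)) →
      σ '' ({x₁, x₂, x₃, x₄, x₅, x₆} : Set P) = {x₁, x₂, x₃, x₄, x₅, x₆} →
      σ '' ({x₁, x₃, x₅} : Set P) = {x₁, x₃, x₅}) ∧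
    ¬ (∀ x ∈ ({x₁, x₂, x₃, x₄, x₅, x₆} : Set P),
        ∀ y ∈ ({x₁, x₂, x₃, x₄, x₅, x₆} : Set P),
        ∃ σ : Equiv.Perm P,
          (∀ a b c : P, (∃ m : L, a ∈ m ∧ b ∈ m ∧ c ∈ m) ↔
            (∃ m : L, σ a ∈ m ∧ σ b ∈ m ∧ σ c ∈ m)) ∧
          σ '' ({x₁, x₂, x₃, x₄, x₅, x₆} : Set P) = {x₁, x₂, x₃, x₄, x₅, x₆} ∧
          σ x = y) := by
  have hnd := nodup_of_ncard_eq_six hdist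
  have hfin : ({x₁, x₂, x₃, x₄, x₅, x₆} : Set P).Finite := Set.toFinite _
  obtain ⟨h₁₁, h₁₂, h₁₃⟩ := hL₁
  obtain ⟨h₂₃, h₂₄, h₂₅⟩ := hL₂
  obtain ⟨h₃₅, h₃₆, h₃₁⟩ := hL₃
  set S : Set P := {x₁, x₂, x₃, x₄, x₅, x₆} with hSdef
  have hV : ({x₁, x₃, x₅} : Set P) ⊆ S := by
    rintro x (rfl | rfl | rfl) <;> simp [hSdef]
  have hfour (m : L) (l : List P) (hl : l.Nodup) (h : 4 ≤ l.length)
      (hm : ∀ x ∈ l, x ∈ S ∧ x ∈ m) : False := by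
    have : l.length ≤ {p | p ∈ S ∧ p ∈ m}.ncard :=
      hl.length_le_ncard (hfin.subset fun _ h => h.1) hm
    have := h4 m
    omega
  have hne₁₂ : L₁ ≠ L₂ := by
    rintro rfl
    exact hfour L₁ [x₁, x₂, x₃, x₄] (hnd.sublist (by simp)) (by simp) (by simp [*])
  have hne₂₃ : L₂ ≠ L₃ := by
    rintro rfl
    exact hfour L₂ [x₃, x₄, x₅, x₆] (hnd.sublist (by simp)) (by simp) (by simp [*])
  have hne₁₃ : L₁ ≠ L₃ := by
    rintro rfl
    exact hfour L₁ [x₁, x₂, x₃, x₅] (by simp at hnd ⊢; tauto) (by simp) (by simp [*])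
  have hmeet {p q : P} {m n : L} (hmn : m ≠ n) (hpm : p ∈ m) (hpn : p ∈ n) (hqm : q ∈ m)
      (hqn : q ∈ n) : p = q :=
    (Nondegenerate.eq_or_eq hpm hqm hpn hqn).resolve_right hmn
  have hvertex {p : P} (hpS : p ∈ S) (hp : IsTriangleVertex L S p) :
      p ∈ ({x₁, x₃, x₅} : Set P) := by
    obtain ⟨m, n, hmn, hpm, hpn, hm, hn⟩ := hp.exists_ne_lines hfin h4 hpS
    have e₁ (h₁ : p ∈ L₁) (h₃ : p ∈ L₃) : p = x₁ := hmeet hne₁₃ h₁ h₃ h₁₁ h₃₁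
    have e₃ (h₁ : p ∈ L₁) (h₂ : p ∈ L₂) : p = x₃ := hmeet hne₁₂ h₁ h₂ h₁₃ h₂₃
    have e₅ (h₂ : p ∈ L₂) (h₃ : p ∈ L₃) : p = x₅ := hmeet hne₂₃ h₂ h₃ h₂₅ h₃₅
    simp only [Set.mem_insert_iff, Set.mem_singleton_iff]
    rcases honly m hm with rfl | rfl | rfl <;> rcases honly n hn with rfl | rfl | rfl <;> tauto
  have hcorner {p : P} (hp : p ∈ ({x₁, x₃, x₅} : Set P)) : IsTriangleVertex L S p := by
    simp only [List.nodup_cons, List.mem_cons] at hnd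
    rcases hp with rfl | rfl | rfl
    · exact ⟨x₂, by simp [hSdef], x₃, by simp [hSdef], x₅, by simp [hSdef], x₆, by simp [hSdef],
        by simp; grind, ⟨L₁, h₁₁, h₁₂, h₁₃⟩, L₃, h₃₁, h₃₅, h₃₆⟩
    · exact ⟨x₁, by simp [hSdef], x₂, by simp [hSdef], x₄, by simp [hSdef], x₅, by simp [hSdef],
        by simp; grind, ⟨L₁, h₁₃, h₁₁, h₁₂⟩, L₂, h₂₃, h₂₄, h₂₅⟩
    · exact ⟨x₃, by simp [hSdef], x₄, by simp [hSdef], x₆, by simp [hSdef], x₁, by simp [hSdef],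
        by simp; grind, ⟨L₂, h₂₅, h₂₃, h₂₄⟩, L₃, h₃₅, h₃₆, h₃₁⟩
  have hmain (σ : Equiv.Perm P)
      (hσ : ∀ a b c : P, (∃ m : L, a ∈ m ∧ b ∈ m ∧ c ∈ m) ↔
        (∃ m : L, σ a ∈ m ∧ σ b ∈ m ∧ σ c ∈ m))
      (hσS : σ '' S = S) : σ '' ({x₁, x₃, x₅} : Set P) = {x₁, x₃, x₅} := by
    have hmaps : Set.MapsTo σ S S := Set.mapsTo_iff_image_subset.mpr hσS.subset
    refine Set.eq_of_subset_of_ncard_le ?_ (Set.ncard_image_of_injective _ σ.injective).ge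
      (Set.toFinite _)
    rintro _ ⟨p, hp, rfl⟩
    exact hvertex (hmaps (hV hp))
      ((hcorner hp).map σ.injective (fun a b c => (hσ a b c).mp) hmaps)
  refine ⟨hmain, fun htrans => ?_⟩
  obtain ⟨σ, hσ, hσS, hσx⟩ := htrans x₁ (by simp [hSdef]) x₂ (by simp [hSdef])
  have hx₂ : x₂ ∈ ({x₁, x₃, x₅} : Set P) :=
    hmain σ hσ hσS ▸ ⟨x₁, by simp, hσx⟩
  simp at hx₂ hnd
  grind
end

section
/- Let d ≥ 2 be an integer and let n₁, …, n_r and b₁, …, b_r be integers with each nᵢ a positive multiple of 3 and each bᵢ ≥ 0, satisfying the two relations 9d² − Σᵢ nᵢbᵢ² = 9 and 9d − Σᵢ nᵢbᵢ = 9. Then there exists an index i with bᵢ ≥ d + 1; equivalently, b := maxᵢ bᵢ satisfies b ≥ d + 1. -/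
/-- The arithmetic content of Lemma 8: if `d ≥ 2` and integers `nᵢ` (positive
multiples of 3) and `bᵢ ≥ 0` satisfy `9d² − Σ nᵢbᵢ² = 9` and
`9d − Σ nᵢbᵢ = 9`, then some `bᵢ` satisfies `bᵢ ≥ d + 1`; equivalently the
maximal multiplicity `b = max bᵢ` satisfies `b ≥ d + 1`. -/
theorem max_multiplicity_ge
    {r : ℕ} (d : ℤ) (hd : 2 ≤ d) (n b : Fin r → ℤ)
    (hn : ∀ i, 0 < n i ∧ (3 : ℤ) ∣ n i) (hb : ∀ i, 0 ≤ b i)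
    (h1 : 9 * d ^ 2 - ∑ i, n i * b i ^ 2 = 9)
    (h2 : 9 * d - ∑ i, n i * b i = 9) :
    ∃ i, d + 1 ≤ b i := by
  by_contra! h
  have hle : ∑ i, n i * b i ^ 2 ≤ d * ∑ i, n i * b i := by
    rw [Finset.mul_sum]
    refine Finset.sum_le_sum fun i _ => ?_
    have hbd : b i ≤ d := Int.lt_add_one_iff.mp (h i)
    calc n i * b i ^ 2 = b i * (n i * b i) := by ring
      _ ≤ d * (n i * b i) :=
        mul_le_mul_of_nonneg_right hbd (mul_nonneg (hn i).1.le (hb i))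
  have hsum : ∑ i, n i * b i = 9 * d - 9 := by linarith
  rw [hsum] at hle
  linarith
end

section
/- Let d ≥ 2 be an integer and let n₁, …, n_r and b₁, …, b_r be integers with each nᵢ a positive multiple of 3 and each bᵢ ≥ 0, satisfying the two relations 9d² − Σᵢ nᵢbᵢ² = 9 and 9d − Σᵢ nᵢbᵢ = 9. If i₀ is an index at which bᵢ attains its maximum, then n_{i₀} ≤ 6; since n_{i₀} is a positive multiple of 3, n_{i₀} = 3 or n_{i₀} = 6. -/
/-- The arithmetic content of Lemma 9: if `d ≥ 2` and integers `nᵢ` (positive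
multiples of 3) and `bᵢ ≥ 0` satisfy `9d² − Σ nᵢbᵢ² = 9` and
`9d − Σ nᵢbᵢ = 9`, and `i₀` is an index at which `bᵢ` attains its maximum,
then `n_{i₀} ≤ 6`; being a positive multiple of `3`, `n_{i₀}` equals `3`
or `6`. -/
theorem degree_of_max_multiplicity_point
    {r : ℕ} (d : ℤ) (hd : 2 ≤ d) (n b : Fin r → ℤ)
    (hn : ∀ i, 0 < n i ∧ (3 : ℤ) ∣ n i) (hb : ∀ i, 0 ≤ b i)
    (h1 : 9 * d ^ 2 - ∑ i, n i * b i ^ 2 = 9)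
    (h2 : 9 * d - ∑ i, n i * b i = 9)
    (i₀ : Fin r) (hmax : ∀ i, b i ≤ b i₀) :
    n i₀ ≤ 6 ∧ (n i₀ = 3 ∨ n i₀ = 6) := by
  have hle : ∑ i, n i * b i ^ 2 ≤ b i₀ * ∑ i, n i * b i := by
    rw [Finset.mul_sum]
    refine Finset.sum_le_sum fun i _ => ?_
    have := mul_le_mul_of_nonneg_left (hmax i) (mul_nonneg (hn i).1.le (hb i))
    linarith
  have hsingle : n i₀ * b i₀ ≤ ∑ i, n i * b i :=
    Finset.single_le_sum (f := fun i => n i * b i)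
      (fun i _ => mul_nonneg (hn i).1.le (hb i)) (Finset.mem_univ i₀)
  have hdb : d + 1 ≤ b i₀ := by
    have hsum : ∑ i, n i * b i = 9 * (d - 1) := by linarith
    rw [hsum] at hle
    refine le_of_mul_le_mul_left ?_ (show 0 < 9 * (d - 1) by linarith)
    linarith
  have hlt : n i₀ < 9 :=
    lt_of_mul_lt_mul_right (show n i₀ * b i₀ < 9 * b i₀ by linarith) (hb i₀)
  have := hn i₀
  omega
end
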